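/- Let k be an algebraically closed field of characteristic p and 0 ≤ λ < p. Let B(λ) be the (λ+1)×(λ+1) tridiagonal matrix over k[s,t] with (i,j) entry −i·t² if i = j+1, (λ−2i)·st if i = j, (λ−i)·s² if i = j−1. Then B(λ)^{λ+1} = 0, and the kernel of B(λ) is the free rank-1 k[s,t]-module generated by the vector G with i-th coordinate (−1)^i·s^{λ−i}·t^i; moreover the j-th column of B(λ)^λ is a scalar multiple of s^j·t^{λ−j}·G, so that the quotient (ker B(λ))/(im B(λ)^λ) is a finite-dimensional k-vector space. -/

import Mathlib

open MvPolynomial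

/-- The tridiagonal matrix `B(λ)` over `k[s,t]` (with `s = X 0`, `t = X 1`) representing the
global operator of the simple Weyl module `V(λ)` pulled back to `ℙ¹`. -/
noncomputable def Bmat (k : Type*) [Field k] (l : ℕ) :
    Matrix (Fin (l + 1)) (Fin (l + 1)) (MvPolynomial (Fin 2) k) :=
  Matrix.of fun i j =>
    if (i : ℕ) = (j : ℕ) + 1 then ((-(i : ℕ) : ℤ) : MvPolynomial (Fin 2) k) * X 1 ^ 2
    else if (i : ℕ) = (j : ℕ) then
      (((l : ℤ) - 2 * (i : ℕ) : ℤ) : MvPolynomial (Fin 2) k) * (X 0 * X 1)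
    else if (j : ℕ) = (i : ℕ) + 1 then
      (((l : ℤ) - (i : ℕ) : ℤ) : MvPolynomial (Fin 2) k) * X 0 ^ 2
    else 0

/-- The generating vector `G = (s^λ, −s^{λ−1}t, …, (−1)^λ t^λ)ᵀ` of `ker B(λ)` for
`0 ≤ λ < p`. -/
noncomputable def Gvec (k : Type*) [Field k] (l : ℕ) :
    Fin (l + 1) → MvPolynomial (Fin 2) k :=
  fun i => (-1 : MvPolynomial (Fin 2) k) ^ (i : ℕ) * X 0 ^ (l - (i : ℕ)) * X 1 ^ (i : ℕ)

section Factorization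

variable (k : Type*) [Field k]

/-- The operator `s ∂_y + t ∂_x` from binary forms of degree `m + 1` to binary forms of
degree `m`, divided by `m + 1`, in the bases `C(n, j) x^(n-j) y^j`. -/
noncomputable def lowerMat (m : ℕ) :
    Matrix (Fin (m + 1)) (Fin (m + 2)) (MvPolynomial (Fin 2) k) :=
  Matrix.of fun i j =>
    if (j : ℕ) = i + 1 then X 0 else if (j : ℕ) = i then X 1 else 0

/-- Multiplication by `s x - t y` from binary forms of degree `m` to binary forms of
degree `m + 1`, times `m + 1`, in the bases `C(n, j) x^(n-j) y^j`. -/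
noncomputable def raiseMat (m : ℕ) :
    Matrix (Fin (m + 2)) (Fin (m + 1)) (MvPolynomial (Fin 2) k) :=
  Matrix.of fun i j =>
    if (i : ℕ) = j then
      ((m : MvPolynomial (Fin 2) k) + 1 - ((i : ℕ) : MvPolynomial (Fin 2) k)) * X 0
    else if (i : ℕ) = j + 1 then -((i : ℕ) : MvPolynomial (Fin 2) k) * X 1 else 0

/-- The row vector `(C(l, j) s^j t^(l-j))_j`, whose product with `Gvec k l`
is `Bmat k l ^ l` up to the factor `l!`. -/
noncomputable def Hvec (l : ℕ) : Fin (l + 1) → MvPolynomial (Fin 2) k :=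
  fun j => (l.choose j : MvPolynomial (Fin 2) k) * X 0 ^ (j : ℕ) * X 1 ^ (l - (j : ℕ))

variable {k}

theorem sum_raiseMat_mul (m : ℕ) (i : Fin (m + 2)) (v : ℕ → MvPolynomial (Fin 2) k) :
    ∑ a, raiseMat k m i a * v a =
      ((m : MvPolynomial (Fin 2) k) + 1 - ((i : ℕ) : MvPolynomial (Fin 2) k)) * X 0 * v i
        - ((i : ℕ) : MvPolynomial (Fin 2) k) * X 1 * v (i - 1) := by
  obtain ⟨i, hi⟩ := i
  have hsplit : ∀ a : Fin (m + 1), raiseMat k m ⟨i, hi⟩ a * v a =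
      (if i = a then
        ((m : MvPolynomial (Fin 2) k) + 1 - ((i : ℕ) : MvPolynomial (Fin 2) k)) * X 0 * v i else 0) +
      (if i = a + 1 then -((i : ℕ) : MvPolynomial (Fin 2) k) * X 1 * v (i - 1) else 0) := by
    intro a
    simp only [raiseMat, Matrix.of_apply]
    split_ifs with h1 h2 h2
    · omega
    · simp [h1]
    · simp [h2]
    · simp
  rw [Finset.sum_congr rfl fun a _ => hsplit a, Finset.sum_add_distrib,
    Fin.sum_univ_eq_sum_range (fun a => if i = a then
      ((m : MvPolynomial (Fin 2) k) + 1 - ((i : ℕ) : MvPolynomial (Fin 2) k)) * X 0 * v i else 0),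
    Fin.sum_univ_eq_sum_range (fun a => if i = a + 1 then
      -((i : ℕ) : MvPolynomial (Fin 2) k) * X 1 * v (i - 1) else 0),
    Finset.sum_ite_eq]
  have hfst : (if i ∈ Finset.range (m + 1) then
      ((m : MvPolynomial (Fin 2) k) + 1 - ((i : ℕ) : MvPolynomial (Fin 2) k)) * X 0 * v i else 0) =
      ((m : MvPolynomial (Fin 2) k) + 1 - ((i : ℕ) : MvPolynomial (Fin 2) k)) * X 0 * v i := by
    split_ifs with h
    · rfl
    · obtain rfl : i = m + 1 := by simp at h; omega
      simp
  rw [hfst]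
  rcases i with _ | i
  · simp
  · have : i < m + 1 := by omega
    simp [this]
    ring

theorem sum_mul_lowerMat (m : ℕ) (j : Fin (m + 2)) (w : ℕ → MvPolynomial (Fin 2) k)
    (hw : w (m + 1) = 0) :
    ∑ a : Fin (m + 1), w a * lowerMat k m a j =
      w j * X 1 + if (j : ℕ) = 0 then 0 else w (j - 1) * X 0 := by
  obtain ⟨j, hj⟩ := j
  have hsplit : ∀ a : Fin (m + 1), w a * lowerMat k m a ⟨j, hj⟩ =
      (if j = a then w j * X 1 else 0) + (if j = a + 1 then w (j - 1) * X 0 else 0) := by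
    intro a
    simp only [lowerMat, Matrix.of_apply]
    split_ifs with h1 h2 h2
    · omega
    · simp [h1]
    · simp [h2]
    · simp
  rw [Finset.sum_congr rfl fun a _ => hsplit a, Finset.sum_add_distrib,
    Fin.sum_univ_eq_sum_range (fun a => if j = a then w j * X 1 else 0),
    Fin.sum_univ_eq_sum_range (fun a => if j = a + 1 then w (j - 1) * X 0 else 0),
    Finset.sum_ite_eq]
  have hfst : (if j ∈ Finset.range (m + 1) then w j * X 1 else 0) = w j * X 1 := by
    split_ifs with h
    · rfl
    · obtain rfl : j = m + 1 := by simp at h; omega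
      simp [hw]
  rw [hfst]
  rcases j with _ | j
  · simp
  · have : j < m + 1 := by omega
    simp [this]

theorem sum_lowerMat_mul (m : ℕ) (v : Fin (m + 2) → MvPolynomial (Fin 2) k) (i : Fin (m + 1)) :
    ∑ a, lowerMat k m i a * v a = X 1 * v i.castSucc + X 0 * v i.succ := by
  have hsplit : ∀ a : Fin (m + 2), lowerMat k m i a * v a =
      (if a = i.castSucc then X 1 * v a else 0) + (if a = i.succ then X 0 * v a else 0) := by
    intro a
    simp only [lowerMat, Matrix.of_apply, Fin.ext_iff, Fin.val_castSucc, Fin.val_succ]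
    split_ifs <;> first | omega | simp
  simp [Finset.sum_congr rfl fun a _ => hsplit a, Finset.sum_add_distrib]

theorem raiseMat_mul_lowerMat (m : ℕ) : raiseMat k m * lowerMat k m = Bmat k (m + 1) := by
  ext1 i j
  rw [Matrix.mul_apply]
  refine (sum_raiseMat_mul m i
    (fun a => if (j : ℕ) = a + 1 then X 0 else if (j : ℕ) = a then X 1 else 0)).trans ?_
  obtain ⟨i, hi⟩ := i
  obtain ⟨j, hj⟩ := j
  simp only [Bmat, Matrix.of_apply]
  rcases i with _ | i
  · rcases j with _ | _ | j <;> simp <;> ring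
  · by_cases h1 : j = i
    · subst h1; simp [show j ≠ j + 1 + 1 by omega]; ring
    · by_cases h2 : j = i + 1
      · subst h2; simp; ring
      · by_cases h3 : j = i + 2
        · subst h3; simp; ring
        · have h4 : i ≠ j := Ne.symm h1
          have h5 : i + 1 ≠ j := Ne.symm h2
          simp [h1, h2, h3, h4, h5]

theorem lowerMat_mul_raiseMat (m : ℕ) : lowerMat k m * raiseMat k m = Bmat k m := by
  ext1 i j
  rw [Matrix.mul_apply, sum_lowerMat_mul m (fun a => raiseMat k m a j)]
  obtain ⟨i, hi⟩ := i
  obtain ⟨j, hj⟩ := j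
  simp only [Bmat, raiseMat, Matrix.of_apply, Fin.val_castSucc, Fin.val_succ]
  by_cases h1 : i = j + 1
  · subst h1; simp [show j + 1 + 1 ≠ j by omega]; ring
  · by_cases h2 : i = j
    · subst h2; simp; ring
    · by_cases h3 : j = i + 1
      · subst h3; simp [show i ≠ i + 1 + 1 by omega]; ring
      · have h4 : i + 1 ≠ j := Ne.symm h3
        simp [h1, h2, h3, h4]

theorem Bmat_succ_pow_succ (m n : ℕ) :
    Bmat k (m + 1) ^ (n + 1) = raiseMat k m * Bmat k m ^ n * lowerMat k m := by
  induction n with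
  | zero => simp [raiseMat_mul_lowerMat]
  | succ n ih =>
    rw [pow_succ, ih, ← raiseMat_mul_lowerMat, pow_succ, ← lowerMat_mul_raiseMat]
    simp only [Matrix.mul_assoc]

theorem Bmat_pow_succ_self (l : ℕ) : Bmat k l ^ (l + 1) = 0 := by
  induction l with
  | zero =>
    ext1 i j
    obtain rfl : i = 0 := Fin.fin_one_eq_zero i
    obtain rfl : j = 0 := Fin.fin_one_eq_zero j
    simp [Bmat]
  | succ m ih => rw [Bmat_succ_pow_succ, ih, Matrix.mul_zero, Matrix.zero_mul]

theorem raiseMat_mulVec_Gvec (m : ℕ) :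
    (raiseMat k m).mulVec (Gvec k m) = (m + 1 : MvPolynomial (Fin 2) k) • Gvec k (m + 1) := by
  ext1 i
  refine (sum_raiseMat_mul m i (fun a => (-1) ^ a * X 0 ^ (m - a) * X 1 ^ a)).trans ?_
  obtain ⟨i, hi⟩ := i
  simp only [Gvec, Pi.smul_apply, smul_eq_mul]
  rcases i with _ | i
  · simp; ring
  · simp only [Nat.add_sub_cancel, Nat.add_sub_add_right]
    obtain rfl | hlt : i = m ∨ i < m := by omega
    · simp; ring
    · obtain ⟨d, rfl⟩ := Nat.exists_eq_add_of_lt hlt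
      have e1 : i + d + 1 - (i + 1) = d := by omega
      have e2 : i + d + 1 - i = d + 1 := by omega
      simp only [e1, e2]
      push_cast
      ring

theorem Hvec_vecMul_lowerMat (m : ℕ) :
    Matrix.vecMul (Hvec k m) (lowerMat k m) = Hvec k (m + 1) := by
  ext1 j
  refine (sum_mul_lowerMat m j (fun a => (m.choose a : MvPolynomial (Fin 2) k) *
    X 0 ^ a * X 1 ^ (m - a)) (by simp)).trans ?_
  obtain ⟨j, hj⟩ := j
  simp only [Hvec]
  rcases j with _ | j
  · simp; ring
  · simp only [Nat.add_sub_cancel, Nat.add_sub_add_right, Nat.choose_succ_succ']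
    obtain rfl | hlt : j = m ∨ j < m := by omega
    · simp; ring
    · obtain ⟨d, rfl⟩ := Nat.exists_eq_add_of_lt hlt
      have e1 : j + d + 1 - (j + 1) = d := by omega
      have e2 : j + d + 1 - j = d + 1 := by omega
      simp [e1, e2]
      ring

theorem Bmat_pow_self (l : ℕ) :
    Bmat k l ^ l =
      (l.factorial : MvPolynomial (Fin 2) k) • Matrix.vecMulVec (Gvec k l) (Hvec k l) := by
  induction l with
  | zero =>
    ext1 i j
    obtain rfl : i = 0 := Fin.fin_one_eq_zero i
    obtain rfl : j = 0 := Fin.fin_one_eq_zero j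
    simp [Matrix.vecMulVec_apply, Gvec, Hvec]
  | succ m ih =>
    rw [Bmat_succ_pow_succ, ih, Matrix.mul_smul, Matrix.smul_mul, Matrix.mul_vecMulVec,
      Matrix.vecMulVec_mul, raiseMat_mulVec_Gvec, Hvec_vecMul_lowerMat, Matrix.smul_vecMulVec,
      smul_smul, Nat.factorial_succ]
    push_cast
    rw [mul_comm]

theorem lowerMat_mulVec_Gvec (m : ℕ) : (lowerMat k m).mulVec (Gvec k (m + 1)) = 0 := by
  ext1 i
  refine (sum_lowerMat_mul m (Gvec k (m + 1)) i).trans ?_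
  have e : m + 1 - (i : ℕ) = m - i + 1 := by omega
  simp [Gvec, e]
  ring

theorem Bmat_mulVec_Gvec (l : ℕ) : (Bmat k l).mulVec (Gvec k l) = 0 := by
  rcases l with _ | m
  · have h : Bmat k 0 = 0 := by simpa using Bmat_pow_succ_self (k := k) 0
    rw [h, Matrix.zero_mulVec]
  · rw [← raiseMat_mul_lowerMat, ← Matrix.mulVec_mulVec, lowerMat_mulVec_Gvec,
      Matrix.mulVec_zero]

end Factorization

section Kernel

variable {k : Type*} [Field k]

theorem natCast_ne_zero_of_lt {R : Type*} [AddMonoidWithOne R] {p : ℕ} [CharP R p] {n : ℕ}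
    (h0 : n ≠ 0) (hn : n < p) : (n : R) ≠ 0 := fun h =>
  hn.not_ge (Nat.le_of_dvd (Nat.pos_of_ne_zero h0) ((CharP.cast_eq_zero_iff R p n).1 h))

theorem X_zero_mul_eq_of_lowerMat_mulVec_eq_zero {m : ℕ} {v : Fin (m + 2) → MvPolynomial (Fin 2) k}
    (hv : (lowerMat k m).mulVec v = 0) (i : Fin (m + 1)) :
    X 0 * v i.succ = -(X 1 * v i.castSucc) := by
  have h := congrFun hv i
  rw [Matrix.mulVec, dotProduct, sum_lowerMat_mul, Pi.zero_apply] at h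
  linear_combination h

/-- For `m + 1 < p` the matrix `raiseMat k m` is injective on vectors. -/
theorem eq_zero_of_raiseMat_mulVec_eq_zero {p : ℕ} [CharP k p] {m : ℕ} (hm : m + 1 < p)
    {w : Fin (m + 1) → MvPolynomial (Fin 2) k} (hw : (raiseMat k m).mulVec w = 0) : w = 0 := by
  let v : ℕ → MvPolynomial (Fin 2) k := fun a => if h : a < m + 1 then w ⟨a, h⟩ else 0
  have hvw (a : Fin (m + 1)) : v a = w a := dif_pos a.2
  have hrow (i : Fin (m + 2)) := (sum_raiseMat_mul m i v).symm.trans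
    ((Finset.sum_congr rfl fun a _ => by rw [hvw]).trans (congrFun hw i))
  have hzero : ∀ a, a < m + 1 → v a = 0 := by
    intro a
    induction a with
    | zero =>
      intro _
      have h := hrow 0
      have hne : ((m + 1 : ℕ) : MvPolynomial (Fin 2) k) ≠ 0 :=
        natCast_ne_zero_of_lt (p := p) (by omega) hm
      push_cast at hne
      simpa [hne] using h
    | succ a ih =>
      intro ha
      have h := hrow ⟨a + 1, by omega⟩
      have hne : ((m - a : ℕ) : MvPolynomial (Fin 2) k) ≠ 0 :=
        natCast_ne_zero_of_lt (p := p) (by omega) (by omega)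
      rw [Nat.cast_sub (by omega)] at hne
      simpa [ih (by omega), hne] using h
  ext1 a
  rw [← hvw, hzero a a.2, Pi.zero_apply]

theorem X_zero_pow_mul_eq_of_lowerMat_mulVec_eq_zero {m : ℕ}
    {v : Fin (m + 2) → MvPolynomial (Fin 2) k} (hv : (lowerMat k m).mulVec v = 0)
    (i : Fin (m + 2)) : X 0 ^ (i : ℕ) * v i = (-1) ^ (i : ℕ) * X 1 ^ (i : ℕ) * v 0 := by
  induction i using Fin.induction with
  | zero => simp
  | succ i ih =>
    have h := X_zero_mul_eq_of_lowerMat_mulVec_eq_zero hv i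
    rw [Fin.val_castSucc] at ih
    rw [Fin.val_succ]
    linear_combination X 0 ^ (i : ℕ) * h - X 1 * ih

theorem exists_eq_smul_Gvec_of_lowerMat_mulVec_eq_zero {m : ℕ}
    {v : Fin (m + 2) → MvPolynomial (Fin 2) k} (hv : (lowerMat k m).mulVec v = 0) :
    ∃ f : MvPolynomial (Fin 2) k, f • Gvec k (m + 1) = v := by
  have hs : (X 0 : MvPolynomial (Fin 2) k) ≠ 0 := X_ne_zero 0
  have hlast := X_zero_pow_mul_eq_of_lowerMat_mulVec_eq_zero hv (Fin.last (m + 1))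
  rw [Fin.val_last] at hlast
  have hprime : Prime (X 0 : MvPolynomial (Fin 2) k) := X_prime
  have hndvd : ¬ (X 0 : MvPolynomial (Fin 2) k) ∣ (-1) ^ (m + 1) * X 1 ^ (m + 1) := by
    intro h
    rcases hprime.dvd_or_dvd h with h | h
    · exact hprime.not_isUnit (isUnit_of_dvd_unit h (IsUnit.pow _ isUnit_one.neg))
    · have h := hprime.dvd_of_dvd_pow h
      rw [X_dvd_X] at h
      simp at h
  obtain ⟨f, hf⟩ : (X 0 : MvPolynomial (Fin 2) k) ^ (m + 1) ∣ v 0 :=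
    hprime.pow_dvd_of_dvd_mul_left _ hndvd (Dvd.intro _ hlast)
  refine ⟨f, ?_⟩
  ext1 i
  have hi := X_zero_pow_mul_eq_of_lowerMat_mulVec_eq_zero hv i
  refine mul_left_cancel₀ (pow_ne_zero (i : ℕ) hs) ?_
  have hle : (i : ℕ) + (m + 1 - i) = m + 1 := by omega
  have hpow : (X 0 : MvPolynomial (Fin 2) k) ^ (m + 1) = X 0 ^ (i : ℕ) * X 0 ^ (m + 1 - i) := by
    rw [← pow_add, hle]
  rw [hi, hf, hpow, Pi.smul_apply, smul_eq_mul, Gvec]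
  ring

theorem ker_Bmat {p : ℕ} [CharP k p] {l : ℕ} (hl : l < p) :
    LinearMap.ker (Bmat k l).mulVecLin
      = Submodule.span (MvPolynomial (Fin 2) k) {Gvec k l} := by
  refine le_antisymm (fun v hv => ?_) ?_
  · rw [LinearMap.mem_ker, Matrix.mulVecLin_apply] at hv
    rw [Submodule.mem_span_singleton]
    rcases l with _ | m
    · refine ⟨v 0, ?_⟩
      ext1 i
      obtain rfl : i = 0 := Fin.fin_one_eq_zero i
      simp [Gvec]
    · rw [← raiseMat_mul_lowerMat, ← Matrix.mulVec_mulVec] at hv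
      exact exists_eq_smul_Gvec_of_lowerMat_mulVec_eq_zero
        (eq_zero_of_raiseMat_mulVec_eq_zero (p := p) hl hv)
  · rw [Submodule.span_singleton_le_iff_mem, LinearMap.mem_ker, Matrix.mulVecLin_apply,
      Bmat_mulVec_Gvec]

end Kernel

/-- A cyclic `k[X_σ]`-module whose generator is killed by a power of every variable is finite
over `k`. -/
theorem MvPolynomial.module_finite_of_X_pow_smul_eq_zero {σ k M : Type*} [Finite σ] [CommRing k]
    [AddCommMonoid M] [Module k M] [Module (MvPolynomial σ k) M]
    [IsScalarTower k (MvPolynomial σ k) M] (g : M)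
    (hg : ∀ x : M, ∃ f : MvPolynomial σ k, f • g = x) (n : ℕ)
    (hn : ∀ i : σ, (X i : MvPolynomial σ k) ^ n • g = 0) : Module.Finite k M := by
  classical
  let D : σ →₀ ℕ := Finsupp.equivFunOnFinite.symm fun _ => n
  let S : Set M := (fun d => monomial d (1 : k) • g) '' Set.Icc 0 D
  have hmon (d : σ →₀ ℕ) : monomial d (1 : k) • g ∈ Submodule.span k S := by
    by_cases hd : d ≤ D
    · exact Submodule.subset_span ⟨d, ⟨zero_le, hd⟩, rfl⟩
    · obtain ⟨i, hi⟩ : ∃ i, n < d i := by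
        simpa [Finsupp.le_def, D] using hd
      have hdvd : (X i : MvPolynomial σ k) ^ n ∣ monomial d 1 := by
        rw [X_pow_eq_monomial, monomial_dvd_monomial]
        exact ⟨Or.inr (Finsupp.single_le_iff.2 hi.le), dvd_rfl⟩
      obtain ⟨q, hq⟩ := hdvd
      rw [hq, mul_comm, mul_smul, hn, smul_zero]
      exact zero_mem _
  have hS : S.Finite := (Set.finite_Icc 0 D).image _
  refine ⟨hS.toFinset, ?_⟩
  rw [Set.Finite.coe_toFinset, eq_top_iff]
  rintro x -
  obtain ⟨f, rfl⟩ := hg x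
  rw [f.as_sum, Finset.sum_smul]
  refine Submodule.sum_mem _ fun d _ => ?_
  have : monomial d (f.coeff d) = f.coeff d • monomial d (1 : k) := by
    rw [smul_monomial, smul_eq_mul, mul_one]
  rw [this, smul_assoc]
  exact Submodule.smul_mem _ _ (hmon d)

theorem Hvec_smul_Gvec_mem_range {k : Type*} [Field k] {l : ℕ} (hfac : (l.factorial : k) ≠ 0)
    (j : Fin (l + 1)) : Hvec k l j • Gvec k l ∈ LinearMap.range (Bmat k l ^ l).mulVecLin := by
  refine ⟨Pi.single j (C (l.factorial : k)⁻¹), ?_⟩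
  have hC : C (l.factorial : k)⁻¹ * (l.factorial : MvPolynomial (Fin 2) k) = 1 := by
    rw [← map_natCast (C : k →+* MvPolynomial (Fin 2) k), ← map_mul, inv_mul_cancel₀ hfac, map_one]
  rw [Matrix.mulVecLin_apply, Bmat_pow_self]
  ext1 i
  simp only [Matrix.mulVec_single, Pi.smul_apply, Matrix.col_apply, Matrix.smul_apply,
    Matrix.vecMulVec_apply, MulOpposite.smul_eq_mul_unop, MulOpposite.unop_op, smul_eq_mul]
  linear_combination Gvec k l i * Hvec k l j * hC

/-- For `k` algebraically closed of characteristic `p` and `0 ≤ λ < p`: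
`B(λ)^{λ+1} = 0`; the kernel of `B(λ)` is generated by `G`; each column `j` of `B(λ)^λ` is a
scalar multiple of `s^j t^{λ−j}·G`; and the quotient `(ker B(λ))/(im B(λ)^λ)` is a
finite-dimensional `k`-vector space. -/
theorem Bmat_pow_and_ker {k : Type*} [Field k] [IsAlgClosed k] {p l : ℕ} (hp : p.Prime)
    (hchar : CharP k p) (hl : l < p) :
    (Bmat k l) ^ (l + 1) = 0 ∧
    LinearMap.ker (Bmat k l).mulVecLin
      = Submodule.span (MvPolynomial (Fin 2) k) {Gvec k l} ∧
    (∀ j : Fin (l + 1), ∃ c : k,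
      (fun i => ((Bmat k l) ^ l) i j)
        = fun i => C c * (X 0 ^ (j : ℕ) * X 1 ^ (l - (j : ℕ)) * Gvec k l i)) ∧
    Module.Finite k (RestrictScalars k (MvPolynomial (Fin 2) k)
      (↥(LinearMap.ker (Bmat k l).mulVecLin) ⧸
        (Submodule.comap (LinearMap.ker (Bmat k l).mulVecLin).subtype
          (LinearMap.range ((Bmat k l ^ l).mulVecLin))))) := by
  have hfac : (l.factorial : k) ≠ 0 := fun h => by
    rw [CharP.cast_eq_zero_iff k p, hp.dvd_factorial] at h
    omega
  have hker : LinearMap.ker (Bmat k l).mulVecLin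
      = Submodule.span (MvPolynomial (Fin 2) k) {Gvec k l} := ker_Bmat (p := p) hl
  have hG : Gvec k l ∈ LinearMap.ker (Bmat k l).mulVecLin := by
    rw [hker]; exact Submodule.mem_span_singleton_self _
  refine ⟨Bmat_pow_succ_self l, hker, fun j => ⟨l.factorial * l.choose j, ?_⟩, ?_⟩
  · ext1 i
    simp only [Bmat_pow_self, Matrix.smul_apply, Matrix.vecMulVec_apply, Hvec, smul_eq_mul,
      map_mul, map_natCast]
    ring
  · set N := Submodule.comap (LinearMap.ker (Bmat k l).mulVecLin).subtype
      (LinearMap.range ((Bmat k l ^ l).mulVecLin))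
    have hgen (x : ↥(LinearMap.ker (Bmat k l).mulVecLin) ⧸ N) :
        ∃ f : MvPolynomial (Fin 2) k, f • N.mkQ ⟨Gvec k l, hG⟩ = x := by
      obtain ⟨⟨v, hv⟩, rfl⟩ := N.mkQ_surjective x
      obtain ⟨f, rfl⟩ := Submodule.mem_span_singleton.1 (hker ▸ hv)
      exact ⟨f, by rw [← map_smul]; rfl⟩
    have hkill (j : Fin (l + 1)) : Hvec k l j • N.mkQ ⟨Gvec k l, hG⟩ = 0 := by
      rw [← map_smul, Submodule.mkQ_apply, Submodule.Quotient.mk_eq_zero]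
      exact Hvec_smul_Gvec_mem_range hfac j
    have hX (i : Fin 2) :
        (X i : MvPolynomial (Fin 2) k) ^ l • N.mkQ ⟨Gvec k l, hG⟩ = 0 := by
      fin_cases i
      · simpa [Hvec] using hkill (Fin.last l)
      · simpa [Hvec] using hkill 0
    let := RestrictScalars.moduleOrig k (MvPolynomial (Fin 2) k)
      (↥(LinearMap.ker (Bmat k l).mulVecLin) ⧸ N)
    exact MvPolynomial.module_finite_of_X_pow_smul_eq_zero
      (M := RestrictScalars k (MvPolynomial (Fin 2) k)
        (↥(LinearMap.ker (Bmat k l).mulVecLin) ⧸ N)) (N.mkQ ⟨Gvec k l, hG⟩) hgen l hX
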